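/- arXiv:0712.2641 — 2 statements merged into one kernel-verified Lean document; each statement's English description precedes it below -/
import Mathlib

section
/- Let k be an algebraically closed field with char k ≠ 2, and V a 7-dimensional k-vector space. For every nondegenerate alternating trilinear form γ on V there exists a basis f₁,…,f₇ of V in which γ takes the standard form γ = f*₁₄₇ + f*₂₄₆ + f*₃₄₅ − f*₁₅₆ − f*₂₃₇ (where f*ₚqᵣ denotes the alternating trilinear form sending (u, v, w) to the determinant of the 3×3 matrix of their coordinates in positions p, q, r with respect to this basis). Consequently, any two nondegenerate alternating trilinear forms γ₁, γ₂ on V are equivalent under GL(V): there is g ∈ GL(V) with γ₂(u, v, w) = γ₁(g·u, g·v, g·w) for all u, v, w ∈ V. -/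
open Module

/-- The alternating trilinear form `f*ₚqᵣ` on coordinate vectors in `k⁷`. -/
def tripleDet {k : Type*} [Field k] (p q r : Fin 7) (u v w : Fin 7 → k) : k :=
  Matrix.det !![u p, u q, u r; v p, v q, v r; w p, w q, w r]

/-- The standard trilinear form `γ₀ = f*₁₄₇ + f*₂₄₆ + f*₃₄₅ − f*₁₅₆ − f*₂₃₇` evaluated on
coordinate vectors. -/
def gammaStd {k : Type*} [Field k] (u v w : Fin 7 → k) : k :=
  tripleDet 0 3 6 u v w + tripleDet 1 3 5 u v w + tripleDet 2 3 4 u v w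
    - tripleDet 0 4 5 u v w - tripleDet 1 2 6 u v w

/-- `γ` is a nondegenerate alternating trilinear form: it admits a compatible
nondegenerate symmetric bilinear form. -/
def IsNondegTrilinear {k : Type*} [Field k] {V : Type*} [AddCommGroup V] [Module k V]
    (γ : V [⋀^Fin 3]→ₗ[k] k) : Prop :=
  ∃ β : V →ₗ[k] V →ₗ[k] k,
    (∀ u v : V, β u v = β v u) ∧
    (∀ u : V, (∀ v : V, β u v = 0) → u = 0) ∧
    (∀ u v : V, ∃ d : V, (∀ x : V, β d x = γ ![u, v, x]) ∧
      2 * γ ![u, v, d] = β u u * β v v - (β u v) ^ 2)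

/-- `C` is an alternating product on `V` for which `β (C u v) w` is alternating and which
satisfies the (rescaled) cross product norm identity with respect to `β`. -/
structure IsCrossProduct {k V : Type*} [Field k] [AddCommGroup V] [Module k V]
    (β : V →ₗ[k] V →ₗ[k] k) (C : V →ₗ[k] V →ₗ[k] V) : Prop where
  symm : ∀ u v, β u v = β v u
  nondeg : ∀ u, (∀ v, β u v = 0) → u = 0
  self : ∀ u, C u u = 0
  orth : ∀ u v, β (C u v) v = 0
  norm : ∀ u v, 2 * β (C u v) (C u v) = β u u * β v v - (β u v) ^ 2

/-- A vector `e` with `β e e = -2`, together with eigenvectors `xᵢ`, `yᵢ` of `C e` for the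
eigenvalues `1`, `-1` forming hyperbolic pairs, where `C x₁ x₂ = y₃` and `C y₁ y₂ = x₃`. -/
structure IsStandardFamily {k V : Type*} [Field k] [AddCommGroup V] [Module k V]
    (β : V →ₗ[k] V →ₗ[k] k) (C : V →ₗ[k] V →ₗ[k] V) (e x₁ x₂ x₃ y₁ y₂ y₃ : V) : Prop where
  norm : β e e = -2
  eigen_x₁ : C e x₁ = x₁
  eigen_x₂ : C e x₂ = x₂
  eigen_x₃ : C e x₃ = x₃
  eigen_y₁ : C e y₁ = -y₁
  eigen_y₂ : C e y₂ = -y₂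
  eigen_y₃ : C e y₃ = -y₃
  product_x : C x₁ x₂ = y₃
  product_y : C y₁ y₂ = x₃
  pair₁₁ : β x₁ y₁ = 1
  pair₁₂ : β x₁ y₂ = 0
  pair₁₃ : β x₁ y₃ = 0
  pair₂₁ : β x₂ y₁ = 0
  pair₂₂ : β x₂ y₂ = 1
  pair₂₃ : β x₂ y₃ = 0
  pair₃₁ : β x₃ y₁ = 0
  pair₃₂ : β x₃ y₂ = 0
  pair₃₃ : β x₃ y₃ = 1

namespace IsCrossProduct

variable {k V : Type*} [Field k] [AddCommGroup V] [Module k V]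
  {β : V →ₗ[k] V →ₗ[k] k} {C : V →ₗ[k] V →ₗ[k] V}

lemma ext (h : IsCrossProduct β C) {u v : V} (huv : ∀ w, β u w = β v w) : u = v :=
  sub_eq_zero.mp (h.nondeg _ fun w => by simp [huv])

lemma swap (h : IsCrossProduct β C) (u v : V) : C u v = -C v u := by
  have h1 := h.self (u + v)
  simp only [map_add, LinearMap.add_apply, h.self, zero_add, add_zero] at h1
  exact eq_neg_of_add_eq_zero_right h1

lemma swap_right (h : IsCrossProduct β C) (u v w : V) : β (C u v) w = -β (C u w) v := by
  have h1 := h.orth u (v + w)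
  simp only [map_add, LinearMap.add_apply, h.orth, zero_add, add_zero] at h1
  exact eq_neg_of_add_eq_zero_right h1

lemma cycle (h : IsCrossProduct β C) (u v w : V) : β (C u v) w = β (C v w) u := by
  rw [h.swap u v, h.swap_right v w u]
  simp

lemma product_left (h : IsCrossProduct β C) (h2 : (2 : k) ≠ 0) (u v w : V) :
    2 * β (C u v) (C u w) = β u u * β v w - β u v * β u w := by
  have h1 := h.norm u (v + w)
  simp only [map_add, LinearMap.add_apply] at h1
  have h3 := h.norm u v
  have h4 := h.norm u w
  have h5 := h.symm (C u w) (C u v)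
  have h6 := h.symm w v
  rw [h5, h6] at h1
  apply mul_left_cancel₀ h2
  linear_combination h1 - h3 - h4

lemma double (h : IsCrossProduct β C) (h2 : (2 : k) ≠ 0) (u v : V) :
    (2 : k) • C u (C u v) = β u v • u - β u u • v := by
  refine h.ext fun w => ?_
  have h1 := h.product_left h2 u w v
  have h3 := h.swap_right u (C u v) w
  have h4 := h.symm w v
  simp only [map_sub, map_smul, LinearMap.sub_apply, LinearMap.smul_apply, smul_eq_mul]
  rw [h3]
  linear_combination -h1 - β u u * h4

lemma double_polar (h : IsCrossProduct β C) (h2 : (2 : k) ≠ 0) (u w v : V) :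
    (2 : k) • (C u (C w v) + C w (C u v)) = β u v • w + β w v • u - (2 * β u w) • v := by
  have h1 := h.double h2 (u + w) v
  have h3 := h.double h2 u v
  have h4 := h.double h2 w v
  have h5 := h.symm w u
  simp only [map_add, LinearMap.add_apply, h5, smul_add] at h1
  linear_combination (norm := module) h1 - h3 - h4

lemma exists_norm_eq [IsAlgClosed k] [Nontrivial V] (h : IsCrossProduct β C)
    (h2 : (2 : k) ≠ 0) (c : k) : ∃ e, β e e = c := by
  obtain ⟨v, hv⟩ : ∃ v, β v v ≠ 0 := by
    by_contra! hall
    obtain ⟨u, hu⟩ := exists_ne (0 : V)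
    refine hu (h.nondeg u fun w => ?_)
    have h1 := hall (u + w)
    simp only [map_add, LinearMap.add_apply, hall, h.symm w u, zero_add, add_zero] at h1
    rw [← two_mul] at h1
    exact (mul_eq_zero.mp h1).resolve_left h2
  obtain ⟨t, ht⟩ := IsAlgClosed.exists_pow_nat_eq (c / β v v) (n := 2) (by norm_num)
  refine ⟨t • v, ?_⟩
  simp only [map_smul, LinearMap.smul_apply, smul_eq_mul]
  rw [← mul_assoc, ← sq, ht, div_mul_cancel₀ _ hv]

section Eigen

variable {e : V}

lemma eigen_orth (h : IsCrossProduct β C) {x : V} {s : k} (hs : s ≠ 0) (hx : C e x = s • x) :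
    β e x = 0 := by
  have h1 := h.swap_right e x e
  rw [hx, h.self] at h1
  simpa [hs, h.symm x e] using h1

lemma eigen_isotropic (h : IsCrossProduct β C) (h2 : (2 : k) ≠ 0) {x x' : V} {s : k}
    (hs : s ≠ 0) (hx : C e x = s • x) (hx' : C e x' = s • x') : β x x' = 0 := by
  have h1 := h.swap_right e x x'
  rw [hx, hx', map_smul, map_smul, LinearMap.smul_apply, LinearMap.smul_apply, h.symm x' x,
    smul_eq_mul] at h1
  have h3 : 2 * (s * β x x') = 0 := by linear_combination h1
  simpa [h2, hs] using h3

lemma eigen_product (h : IsCrossProduct β C) (h2 : (2 : k) ≠ 0) {x x' : V} {s : k}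
    (hs : s ≠ 0) (hx : C e x = s • x) (hx' : C e x' = s • x') :
    C e (C x x') = (-s) • C x x' := by
  have h1 := h.double_polar h2 e x x'
  rw [h.eigen_orth hs hx, h.eigen_orth hs hx', h.eigen_isotropic h2 hs hx hx', hx'] at h1
  simp only [zero_smul, mul_zero, add_zero, sub_zero, smul_eq_zero, h2, false_or, map_smul] at h1
  rw [neg_smul]
  exact eq_neg_of_add_eq_zero_left h1

lemma eigen_triple (h : IsCrossProduct β C) (h2 : (2 : k) ≠ 0) {x x' y : V} {s : k}
    (hs : s ≠ 0) (hx : C e x = s • x) (hx' : C e x' = s • x') (hy : C e y = (-s) • y) :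
    β (C x x') y = 0 :=
  h.eigen_isotropic h2 (neg_ne_zero.mpr hs) (h.eigen_product h2 hs hx hx') hy

lemma double_of_orth (h : IsCrossProduct β C) (h2 : (2 : k) ≠ 0) (he : β e e = -2) {v : V}
    (hv : β e v = 0) : C e (C e v) = v := by
  have h1 := h.double h2 e v
  rw [hv, he, zero_smul, zero_sub, neg_smul, neg_neg] at h1
  exact smul_right_injective V h2 h1

/-- A `C e`-stable subspace of the orthogonal complement of `e` on which `β` does not vanish
contains a hyperbolic pair of eigenvectors of `C e`. -/
lemma exists_hyperbolic_pair (h : IsCrossProduct β C) (h2 : (2 : k) ≠ 0) (he : β e e = -2)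
    (U : Submodule k V) (hUe : ∀ v ∈ U, β e v = 0) (hUC : ∀ v ∈ U, C e v ∈ U) {v w : V}
    (hv : v ∈ U) (hw : w ∈ U) (hvw : β v w ≠ 0) :
    ∃ x ∈ U, ∃ y ∈ U, C e x = x ∧ C e y = -y ∧ β x y = 1 := by
  have key : ∀ a ∈ U, ∀ b ∈ U, β (a + C e a) (b - C e b) ≠ 0 →
      ∃ x ∈ U, ∃ y ∈ U, C e x = x ∧ C e y = -y ∧ β x y = 1 := by
    intro a ha b hb hab
    refine ⟨(β (a + C e a) (b - C e b))⁻¹ • (a + C e a),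
      U.smul_mem _ (U.add_mem ha (hUC a ha)), b - C e b, U.sub_mem hb (hUC b hb), ?_, ?_, ?_⟩
    · rw [map_smul, map_add (C e), h.double_of_orth h2 he (hUe a ha), add_comm]
    · rw [map_sub (C e), h.double_of_orth h2 he (hUe b hb), neg_sub]
    · rw [map_smul, LinearMap.smul_apply, smul_eq_mul, inv_mul_cancel₀ hab]
  by_contra hno
  have h1 : β (v + C e v) (w - C e w) = 0 := by
    by_contra hne; exact hno (key v hv w hw hne)
  have h3 : β (w + C e w) (v - C e v) = 0 := by
    by_contra hne; exact hno (key w hw v hv hne)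
  have h4 := h.swap_right e v w
  have h5 := h.swap_right e v (C e w)
  rw [h.double_of_orth h2 he (hUe w hw)] at h5
  simp only [map_add, map_sub, LinearMap.add_apply] at h1 h3
  have h6 := h.symm w v
  have h7 := h.symm w (C e v)
  have h8 := h.symm (C e w) (C e v)
  have h9 := h.symm v (C e w)
  have h10 : 2 * (2 * β v w) = 0 := by
    linear_combination h1 + h3 - h6 + h7 + h8 + h9 + 2 * h5 - 2 * h.symm w v
  simp [h2, hvw] at h10

end Eigen

lemma exists_orth_ne_zero [FiniteDimensional k V] (β : V →ₗ[k] V →ₗ[k] k) {n : ℕ}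
    (hn : n < finrank k V) (a : Fin n → V) : ∃ v ≠ 0, ∀ i, β (a i) v = 0 := by
  have h1 : LinearMap.ker (LinearMap.pi fun i => β (a i)) ≠ ⊥ :=
    LinearMap.ker_ne_bot_of_finrank_lt (by simpa using hn)
  obtain ⟨v, hv, hv0⟩ := Submodule.exists_mem_ne_zero_of_ne_bot h1
  exact ⟨v, hv0, fun i => congrFun hv i⟩

lemma exists_ne_of_ne_zero (h : IsCrossProduct β C) {v : V} (hv : v ≠ 0) :
    ∃ w, β v w ≠ 0 := by
  by_contra! hall
  exact hv (h.nondeg v hall)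

/-- Two orthogonal hyperbolic pairs of eigenvectors of `C e`. -/
lemma exists_two_hyperbolic_pairs [FiniteDimensional k V] (h : IsCrossProduct β C)
    (h2 : (2 : k) ≠ 0) (hdim : finrank k V = 7) {e : V} (he : β e e = -2) :
    ∃ x₁ y₁ x₂ y₂ : V, C e x₁ = x₁ ∧ C e y₁ = -y₁ ∧ C e x₂ = x₂ ∧ C e y₂ = -y₂ ∧
      β x₁ y₁ = 1 ∧ β x₂ y₂ = 1 ∧ β x₁ y₂ = 0 ∧ β x₂ y₁ = 0 := by
  have hself : ∀ v, β e (C e v) = 0 := fun v => by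
    rw [h.symm, h.swap_right, h.self]; simp
  obtain ⟨x₁, -, y₁, -, hx₁, hy₁, h₁⟩ : ∃ x ∈ LinearMap.ker (β e), ∃ y ∈ LinearMap.ker (β e),
      C e x = x ∧ C e y = -y ∧ β x y = 1 := by
    obtain ⟨v, hv0, hv⟩ := exists_orth_ne_zero β (n := 1) (by omega) ![e]
    obtain ⟨w, hw⟩ := h.exists_ne_of_ne_zero hv0
    have hev : β e v = 0 := by simpa using hv 0
    refine h.exists_hyperbolic_pair h2 he _ (fun v hv => hv) (fun v _ => hself v) (v := v)
      (w := (2 : k) • w + β e w • e) hev ?_ ?_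
    · simp only [LinearMap.mem_ker, map_add, map_smul, smul_eq_mul, he]
      ring
    · simpa [h.symm v e, hev, h2] using hw
  have hex : β e x₁ = 0 := h.eigen_orth one_ne_zero (by simpa using hx₁)
  have hey : β e y₁ = 0 := h.eigen_orth (s := -1) (by simp) (by simpa using hy₁)
  have hxx : β x₁ x₁ = 0 := h.eigen_isotropic h2 one_ne_zero (e := e) (by simpa using hx₁)
    (by simpa using hx₁)
  have hyy : β y₁ y₁ = 0 := h.eigen_isotropic h2 (s := -1) (by simp) (e := e)
    (by simpa using hy₁) (by simpa using hy₁)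
  obtain ⟨v, hv0, hv⟩ := exists_orth_ne_zero β (n := 3) (by omega) ![e, x₁, y₁]
  obtain ⟨w, hw⟩ := h.exists_ne_of_ne_zero hv0
  have hev : β e v = 0 := by simpa using hv 0
  have hxv : β x₁ v = 0 := by simpa using hv 1
  have hyv : β y₁ v = 0 := by simpa using hv 2
  obtain ⟨x₂, hx₂U, y₂, hy₂U, hx₂, hy₂, h₂⟩ := h.exists_hyperbolic_pair h2 he
    (LinearMap.ker (β e) ⊓ (LinearMap.ker (β x₁) ⊓ LinearMap.ker (β y₁)))
    (fun v hv => hv.1)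
    (fun v hv => by
      simp only [Submodule.mem_inf, LinearMap.mem_ker] at hv
      obtain ⟨-, h3, h4⟩ := hv
      refine ⟨hself v, ?_, ?_⟩
      · show β x₁ (C e v) = 0
        rw [h.symm, h.swap_right, hx₁, h3, neg_zero]
      · show β y₁ (C e v) = 0
        rw [h.symm, h.swap_right, hy₁, map_neg, LinearMap.neg_apply, h4,
          neg_zero, neg_zero])
    (v := v) (w := (2 : k) • (w - β y₁ w • x₁ - β x₁ w • y₁) + β e w • e)
    ⟨hev, hxv, hyv⟩
    (by
      simp only [Submodule.mem_inf, LinearMap.mem_ker, map_add, map_sub, map_smul, smul_eq_mul,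
        he, hex, hey, hxx, hyy, h₁, h.symm y₁ x₁, h.symm x₁ e, h.symm y₁ e]
      refine ⟨?_, ?_, ?_⟩ <;> ring)
    (by simpa [h.symm v e, h.symm v x₁, h.symm v y₁, hev, hxv, hyv, h2] using hw)
  exact ⟨x₁, y₁, x₂, y₂, hx₁, hy₁, hx₂, hy₂, h₁, h₂, hy₂U.2.1, (h.symm _ _).trans hx₂U.2.2⟩

/-- For hyperbolic pairs `x₁, y₁` and `x₂, y₂` as above, so is `y₁ × y₂, x₁ × x₂`. -/
lemma product_pairing (h : IsCrossProduct β C) (h2 : (2 : k) ≠ 0) {e x₁ y₁ x₂ y₂ : V}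
    (hx₁ : C e x₁ = x₁) (hx₂ : C e x₂ = x₂)
    (hy₂ : C e y₂ = -y₂) (h₁ : β x₁ y₁ = 1) (h₂ : β x₂ y₂ = 1)
    (h₁₂ : β x₁ y₂ = 0) : β (C y₁ y₂) (C x₁ x₂) = 1 := by
  have hxx : β x₁ x₂ = 0 := h.eigen_isotropic h2 one_ne_zero (e := e) (by simpa using hx₁)
    (by simpa using hx₂)
  have hprod : (2 : k) • C y₂ x₂ = e := by
    have h3 := h.double_polar h2 y₂ x₂ e
    rw [h.symm y₂ e, h.symm x₂ e, h.eigen_orth (s := -1) (by simp) (by simpa using hy₂),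
      h.eigen_orth one_ne_zero (by simpa using hx₂), h.symm y₂ x₂, h₂, h.swap x₂ e,
      h.swap y₂ e, hx₂, hy₂, neg_neg, map_neg, h.swap x₂ y₂] at h3
    refine smul_right_injective V h2 ?_
    linear_combination (norm := module) -h3
  have h3 := h.double_polar h2 y₂ x₁ x₂
  rw [h.symm y₂ x₂, h.symm y₂ x₁, h₂, h₁₂, hxx, smul_add, ← map_smul (C x₁), hprod,
    h.swap x₁ e, hx₁] at h3
  have h4 : (2 : k) • C y₂ (C x₁ x₂) = (2 : k) • x₁ := by
    linear_combination (norm := module) h3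
  rw [h.cycle, smul_right_injective V h2 h4, h₁]


lemma exists_isStandardFamily [IsAlgClosed k] [FiniteDimensional k V] (h : IsCrossProduct β C)
    (h2 : (2 : k) ≠ 0) (hdim : finrank k V = 7) :
    ∃ e x₁ x₂ x₃ y₁ y₂ y₃ : V, IsStandardFamily β C e x₁ x₂ x₃ y₁ y₂ y₃ := by
  have : Nontrivial V := Module.nontrivial_of_finrank_pos (R := k) (by omega)
  obtain ⟨e, he⟩ := h.exists_norm_eq h2 (-2)
  obtain ⟨x₁, y₁, x₂, y₂, hx₁, hy₁, hx₂, hy₂, h₁₁, h₂₂, h₁₂, h₂₁⟩ :=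
    h.exists_two_hyperbolic_pairs h2 hdim he
  refine ⟨e, x₁, x₂, C y₁ y₂, y₁, y₂, C x₁ x₂, ⟨he, hx₁, hx₂, ?_, hy₁, hy₂, ?_, rfl, rfl,
    h₁₁, h₁₂, ?_, h₂₁, h₂₂, ?_, ?_, h.orth _ _,
    h.product_pairing h2 hx₁ hx₂ hy₂ h₁₁ h₂₂ h₁₂⟩⟩
  · simpa using h.eigen_product h2 (s := -1) (by simp) (e := e) (x := y₁) (x' := y₂)
      (by simpa using hy₁) (by simpa using hy₂)
  · simpa using h.eigen_product h2 one_ne_zero (e := e) (x := x₁) (x' := x₂)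
      (by simpa using hx₁) (by simpa using hx₂)
  · rw [h.symm, h.cycle, h.orth]
  · rw [h.symm, h.orth]
  · rw [h.cycle, h.orth]

lemma linearIndependent (h : IsCrossProduct β C) (h2 : (2 : k) ≠ 0) {e x₁ x₂ x₃ y₁ y₂ y₃ : V}
    (hs : IsStandardFamily β C e x₁ x₂ x₃ y₁ y₂ y₃) :
    LinearIndependent k ![y₁, x₂, x₃, -e, y₃, y₂, -x₁] := by
  obtain ⟨he, hx₁, hx₂, hx₃, hy₁, hy₂, hy₃, hC₁, hC₂, h₁₁, h₁₂, h₁₃, h₂₁, h₂₂, h₂₃, h₃₁, h₃₂,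
    h₃₃⟩ := hs
  have ex : ∀ x, C e x = x → β e x = 0 := fun x hx => h.eigen_orth one_ne_zero (by simpa using hx)
  have ey : ∀ y, C e y = -y → β e y = 0 := fun y hy =>
    h.eigen_orth (s := -1) (by simp) (by simpa using hy)
  have xx : ∀ x x', C e x = x → C e x' = x' → β x x' = 0 := fun x x' hx hx' =>
    h.eigen_isotropic h2 one_ne_zero (by simpa using hx) (by simpa using hx')
  have yy : ∀ y y', C e y = -y → C e y' = -y' → β y y' = 0 := fun y y' hy hy' =>
    h.eigen_isotropic h2 (s := -1) (by simp) (by simpa using hy) (by simpa using hy')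
  set F : Fin 7 → V := ![y₁, x₂, x₃, -e, y₃, y₂, -x₁]
  rw [Fintype.linearIndependent_iff]
  intro g hg i
  have hz : ∀ z, β z (∑ i, g i • F i) = 0 := fun z => by rw [hg, map_zero]
  have hxs : ∀ x, C e x = x → β x e = 0 := fun x hx => (h.symm _ _).trans (ex x hx)
  have hys : ∀ y, C e y = -y → β y e = 0 := fun y hy => (h.symm _ _).trans (ey y hy)
  have g0 := hz x₁
  have g1 := hz y₂
  have g2 := hz y₃
  have g3 := hz e
  have g4 := hz x₃
  have g5 := hz x₂
  have g6 := hz y₁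
  have hF0 : F 0 = y₁ := rfl
  have hF1 : F 1 = x₂ := rfl
  have hF2 : F 2 = x₃ := rfl
  have hF3 : F 3 = -e := rfl
  have hF4 : F 4 = y₃ := rfl
  have hF5 : F 5 = y₂ := rfl
  have hF6 : F 6 = -x₁ := rfl
  simp [Fin.sum_univ_seven, hF0, hF1, hF2, hF3, hF4, hF5, hF6, he, hx₁, hx₂, hx₃, hy₁, hy₂,
    hy₃, h₁₁, h₁₂, h₁₃, h₂₁, h₂₂, h₂₃, h₃₁, h₃₂, h₃₃, ex, ey, hxs, hys, xx, yy, h2,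
    h.symm y₁ x₁, h.symm y₁ x₂, h.symm y₁ x₃, h.symm y₂ x₁, h.symm y₂ x₂, h.symm y₂ x₃,
    h.symm y₃ x₁, h.symm y₃ x₂, h.symm y₃ x₃] at g0 g1 g2 g3 g4 g5 g6
  fin_cases i <;> assumption

set_option maxHeartbeats 1600000 in
set_option linter.unusedSimpArgs false in
lemma standard_values (h : IsCrossProduct β C) (h2 : (2 : k) ≠ 0) {e x₁ x₂ x₃ y₁ y₂ y₃ : V}
    (hs : IsStandardFamily β C e x₁ x₂ x₃ y₁ y₂ y₃) (i j l : Fin 7) (hij : i < j) (hjl : j < l) :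
    β (C (![y₁, x₂, x₃, -e, y₃, y₂, -x₁] i) (![y₁, x₂, x₃, -e, y₃, y₂, -x₁] j))
      (![y₁, x₂, x₃, -e, y₃, y₂, -x₁] l) =
      gammaStd (Pi.single i 1) (Pi.single j 1) (Pi.single l 1) := by
  obtain ⟨-, hx₁, hx₂, hx₃, hy₁, hy₂, hy₃, hC₁, hC₂, h₁₁, h₁₂, h₁₃, h₂₁, h₂₂, h₂₃, h₃₁, h₃₂,
    h₃₃⟩ := hs
  have xx : ∀ x x', C e x = x → C e x' = x' → β x x' = 0 := fun x x' hx hx' =>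
    h.eigen_isotropic h2 one_ne_zero (by simpa using hx) (by simpa using hx')
  have yy : ∀ y y', C e y = -y → C e y' = -y' → β y y' = 0 := fun y y' hy hy' =>
    h.eigen_isotropic h2 (s := -1) (by simp) (by simpa using hy) (by simpa using hy')
  have xxy : ∀ x x' y, C e x = x → C e x' = x' → C e y = -y → β (C x x') y = 0 :=
    fun x x' y hx hx' hy => h.eigen_triple h2 (s := 1) one_ne_zero (by simpa using hx)
      (by simpa using hx') (by simpa using hy)
  have yyx : ∀ y y' x, C e y = -y → C e y' = -y' → C e x = x → β (C y y') x = 0 :=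
    fun y y' x hy hy' hx => h.eigen_triple h2 (s := -1) (by simp) (by simpa using hy)
      (by simpa using hy') (by simpa using hx)
  have hCe : ∀ u, C u e = -C e u := fun u => h.swap u e
  have hβe : ∀ u v, β (C u v) e = β (C e u) v := fun u v => (h.cycle _ _ _).symm
  have xyx : ∀ x y x', C e x = x → C e y = -y → C e x' = x' → β (C x y) x' = 0 :=
    fun x y x' hx hy hx' => by rw [h.swap_right, xxy x x' y hx hx' hy, neg_zero]
  have yxx : ∀ y x x', C e y = -y → C e x = x → C e x' = x' → β (C y x) x' = 0 :=
    fun y x x' hy hx hx' => by rw [h.cycle, xxy x x' y hx hx' hy]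
  have yxy : ∀ y x y', C e y = -y → C e x = x → C e y' = -y' → β (C y x) y' = 0 :=
    fun y x y' hy hx hy' => by rw [h.swap_right, yyx y y' x hy hy' hx, neg_zero]
  have xyy : ∀ x y y', C e x = x → C e y = -y → C e y' = -y' → β (C x y) y' = 0 :=
    fun x y y' hx hy hy' => by rw [h.cycle, yyx y y' x hy hy' hx]
  have hxxx : β (C x₂ x₃) x₁ = 1 := by rw [← h.cycle, hC₁, h.symm, h₃₃]
  have hyyy : β (C y₁ y₃) y₂ = -1 := by rw [h.swap_right, hC₂, h₃₃]
  fin_cases i <;> fin_cases j <;> first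
    | exact absurd hij (by decide)
    | (fin_cases l <;> first
        | exact absurd hjl (by decide)
        | simp [gammaStd, tripleDet, Matrix.det_fin_three, h.self e,
            hCe y₁, hCe x₂, hCe x₃, hβe, hx₁, hx₂, hx₃, hy₁, hy₂,
            hy₃, h₁₁, h₁₂, h₁₃, h₂₁, h₂₂, h₂₃, h₃₁, h₃₂, h₃₃, xx, yy, xxy, xyx, yxx, yyx, yxy,
            xyy, hxxx, hyyy, h.symm y₁ x₁, h.symm y₁ x₂, h.symm y₁ x₃, h.symm y₂ x₁, h.symm y₂ x₂,
            h.symm y₂ x₃, h.symm y₃ x₁, h.symm y₃ x₂, h.symm y₃ x₃])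

end IsCrossProduct

/-- The coordinate form `f*ₚqᵣ` as an alternating map. -/
noncomputable def tripleDetAlternating {k V : Type*} [Field k] [AddCommGroup V] [Module k V]
    (f : Basis (Fin 7) k V) (p q r : Fin 7) : V [⋀^Fin 3]→ₗ[k] k :=
  Matrix.detRowAlternating.compLinearMap (LinearMap.pi ![f.coord p, f.coord q, f.coord r])

lemma tripleDetAlternating_apply {k V : Type*} [Field k] [AddCommGroup V] [Module k V]
    (f : Basis (Fin 7) k V) (p q r : Fin 7) (u v w : V) :
    tripleDetAlternating f p q r ![u, v, w] = tripleDet p q r (f.repr u) (f.repr v) (f.repr w) := by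
  rw [tripleDetAlternating, AlternatingMap.compLinearMap_apply, tripleDet]
  change Matrix.det _ = _
  congr 1
  ext i j
  fin_cases i <;> fin_cases j <;> rfl

lemma AlternatingMap.ext_basis_strictMono {k V ι : Type*} [Field k] [AddCommGroup V]
    [Module k V] [LinearOrder ι] [Finite ι] {n : ℕ} (f : Basis ι k V)
    {γ δ : V [⋀^Fin n]→ₗ[k] k}
    (h : ∀ v : Fin n → ι, StrictMono v → γ (f ∘ v) = δ (f ∘ v)) : γ = δ := by
  refine f.ext_alternating fun v hv => ?_
  have h1 := h (v ∘ Tuple.sort v)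
    ((Tuple.monotone_sort v).strictMono_of_injective (hv.comp (Tuple.sort v).injective))
  rw [← Function.comp_assoc, γ.map_perm, δ.map_perm] at h1
  exact smul_left_cancel _ h1

lemma exists_isCrossProduct {k V : Type*} [Field k] [AddCommGroup V] [Module k V]
    {γ : V [⋀^Fin 3]→ₗ[k] k} (hγ : IsNondegTrilinear γ) :
    ∃ (β : V →ₗ[k] V →ₗ[k] k) (C : V →ₗ[k] V →ₗ[k] V), IsCrossProduct β C ∧
      ∀ u v w, γ ![u, v, w] = β (C u v) w := by
  obtain ⟨β, hsymm, hnd, hd⟩ := hγ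
  choose d hd hnorm using hd
  have hext : ∀ u v, (∀ w, β u w = β v w) → u = v := fun u v huv =>
    sub_eq_zero.mp (hnd _ fun w => by simp [huv])
  have hupdate : ∀ u v w v' : V, Function.update ![u, v, w] 1 v' = ![u, v', w] := by
    intro u v w v'
    ext i
    fin_cases i <;> rfl
  refine ⟨β, LinearMap.mk₂ k d ?_ ?_ ?_ ?_, ⟨hsymm, hnd, ?_, ?_, ?_⟩, ?_⟩
  · refine fun u u' v => hext _ _ fun w => ?_
    simpa [hd] using γ.map_vecCons_add ![v, w] u u'
  · refine fun c u v => hext _ _ fun w => ?_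
    simpa [hd] using γ.map_vecCons_smul ![v, w] c u
  · refine fun u v v' => hext _ _ fun w => ?_
    have h1 := γ.map_update_add ![u, v, w] 1 v v'
    simpa only [hupdate, LinearMap.add_apply, map_add, hd] using h1
  · refine fun c u v => hext _ _ fun w => ?_
    have h1 := γ.map_update_smul ![u, v, w] 1 c v
    simpa only [hupdate, LinearMap.smul_apply, map_smul, hd] using h1
  · refine fun u => hnd _ fun w => ?_
    rw [LinearMap.mk₂_apply, hd]
    exact γ.map_eq_zero_of_eq _ (i := 0) (j := 1) rfl (by decide)
  · intro u v
    rw [LinearMap.mk₂_apply, hd]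
    exact γ.map_eq_zero_of_eq _ (i := 1) (j := 2) rfl (by decide)
  · intro u v
    rw [LinearMap.mk₂_apply, hd, hnorm]
  · intro u v w
    rw [LinearMap.mk₂_apply, hd]

lemma IsNondegTrilinear.exists_basis {k V : Type*} [Field k] [IsAlgClosed k]
    (h2 : (2 : k) ≠ 0) [AddCommGroup V] [Module k V] [FiniteDimensional k V]
    (hdim : finrank k V = 7) {γ : V [⋀^Fin 3]→ₗ[k] k} (hγ : IsNondegTrilinear γ) :
    ∃ f : Basis (Fin 7) k V, ∀ u v w : V,
      γ ![u, v, w] = gammaStd (f.repr u) (f.repr v) (f.repr w) := by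
  obtain ⟨β, C, h, hγβ⟩ := exists_isCrossProduct hγ
  obtain ⟨e, x₁, x₂, x₃, y₁, y₂, y₃, hs⟩ := h.exists_isStandardFamily h2 hdim
  have hF := h.linearIndependent h2 hs
  let f := basisOfLinearIndependentOfCardEqFinrank hF (by simp [hdim])
  have hfF : ⇑f = ![y₁, x₂, x₃, -e, y₃, y₂, -x₁] :=
     coe_basisOfLinearIndependentOfCardEqFinrank hF _
  have key : γ = tripleDetAlternating f 0 3 6 + tripleDetAlternating f 1 3 5
      + tripleDetAlternating f 2 3 4 - tripleDetAlternating f 0 4 5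
      - tripleDetAlternating f 1 2 6 := by
    refine AlternatingMap.ext_basis_strictMono f fun v hv => ?_
    have hv' : f ∘ v = ![f (v 0), f (v 1), f (v 2)] := by
      ext i; fin_cases i <;> rfl
    rw [hv', hγβ, hfF,
      h.standard_values h2 hs _ _ _ (hv (by decide : (0 : Fin 3) < 1))
      (hv (by decide : (1 : Fin 3) < 2)), ← hfF, gammaStd]
    simp only [AlternatingMap.add_apply, AlternatingMap.sub_apply, tripleDetAlternating_apply,
      Basis.repr_self, Finsupp.single_eq_pi_single]
  refine ⟨f, fun u v w => ?_⟩
  rw [key, gammaStd]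
  simp only [AlternatingMap.add_apply, AlternatingMap.sub_apply, tripleDetAlternating_apply]

/-- Every nondegenerate alternating trilinear form on a 7-dimensional
space over an algebraically closed field of characteristic `≠ 2` takes the standard form
in a suitable basis; consequently any two nondegenerate alternating trilinear forms are
`GL(V)`-equivalent. -/
theorem nondeg_trilinear_standard_form
    {k : Type*} [Field k] [IsAlgClosed k] (hchar : (2 : k) ≠ 0)
    {V : Type*} [AddCommGroup V] [Module k V] [FiniteDimensional k V]
    (hdim : finrank k V = 7) :
    (∀ γ : V [⋀^Fin 3]→ₗ[k] k, IsNondegTrilinear γ →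
      ∃ f : Basis (Fin 7) k V, ∀ u v w : V,
        γ ![u, v, w] = gammaStd (⇑(f.repr u)) (⇑(f.repr v)) (⇑(f.repr w))) ∧
    (∀ γ₁ γ₂ : V [⋀^Fin 3]→ₗ[k] k, IsNondegTrilinear γ₁ → IsNondegTrilinear γ₂ →
      ∃ g : V ≃ₗ[k] V, ∀ u v w : V, γ₂ ![u, v, w] = γ₁ ![g u, g v, g w]) := by
  refine ⟨fun γ hγ => hγ.exists_basis hchar hdim, fun γ₁ γ₂ h₁ h₂ => ?_⟩
  obtain ⟨f₁, hf₁⟩ := h₁.exists_basis hchar hdim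
  obtain ⟨f₂, hf₂⟩ := h₂.exists_basis hchar hdim
  refine ⟨f₂.repr.trans f₁.repr.symm, fun u v w => ?_⟩
  simp [hf₁, hf₂]
end

section
/- Let k be an algebraically closed field with char k ≠ 2, V a 7-dimensional k-vector space, γ a nondegenerate alternating trilinear form on V, and β a nondegenerate symmetric bilinear form compatible with γ. Then a nonzero vector v ∈ V lies in some 2-dimensional γ-isotropic subspace of V if and only if β(v, v) = 0. -/
open Module

/-- A 3-form as an iterated linear map. -/
def AlternatingMap.toTrilin {k V : Type*} [Field k] [AddCommGroup V] [Module k V]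
    (γ : V [⋀^Fin 3]→ₗ[k] k) : V →ₗ[k] V →ₗ[k] V →ₗ[k] k :=
  LinearMap.mk₂ k
    (fun u w =>
      { toFun := fun x => ((γ.curryLeft u).curryLeft w).curryLeft x ![]
        map_add' := fun x x' => by rw [map_add, AlternatingMap.add_apply]
        map_smul' := fun c x => by
          rw [map_smul, AlternatingMap.smul_apply, RingHom.id_apply] })
    (fun u u' w => by
      ext x
      simp only [map_add, AlternatingMap.curryLeft_add, LinearMap.add_apply,
        AlternatingMap.add_apply, LinearMap.coe_mk, AddHom.coe_mk])
    (fun c u w => by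
      ext x
      simp only [map_smul, AlternatingMap.curryLeft_smul, LinearMap.smul_apply,
        AlternatingMap.smul_apply, LinearMap.coe_mk, AddHom.coe_mk])
    (fun u w w' => by
      ext x
      simp only [map_add, AlternatingMap.curryLeft_add, LinearMap.add_apply,
        AlternatingMap.add_apply, LinearMap.coe_mk, AddHom.coe_mk])
    (fun c u w => by
      ext x
      simp only [map_smul, AlternatingMap.curryLeft_smul, LinearMap.smul_apply,
        AlternatingMap.smul_apply, LinearMap.coe_mk, AddHom.coe_mk])

section CrossProduct

variable {k V : Type*} [Field k] [AddCommGroup V] [Module k V]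

theorem AlternatingMap.toTrilin_apply (γ : V [⋀^Fin 3]→ₗ[k] k) (u w x : V) :
    γ.toTrilin u w x = γ ![u, w, x] := rfl

theorem AlternatingMap.toTrilin_self (γ : V [⋀^Fin 3]→ₗ[k] k) (u x : V) :
    γ.toTrilin u u x = 0 :=
  γ.map_eq_zero_of_eq ![u, u, x] (i := 0) (j := 1) rfl (by decide)

theorem AlternatingMap.toTrilin_swap (γ : V [⋀^Fin 3]→ₗ[k] k) (u w x : V) :
    γ.toTrilin u w x = -γ.toTrilin u x w := by
  have alt (y : V) : γ.toTrilin u y y = 0 :=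
    γ.map_eq_zero_of_eq ![u, y, y] (i := 1) (j := 2) rfl (by decide)
  have h := alt (w + x)
  simp only [map_add, LinearMap.add_apply, alt] at h
  linear_combination h

/-- Left multiplication by `u` in the cross product defined by `β` and `γ`. -/
theorem exists_cross_left [FiniteDimensional k V] (β : V →ₗ[k] V →ₗ[k] k)
    (hβnd : ∀ u : V, (∀ v : V, β u v = 0) → u = 0) (γ : V [⋀^Fin 3]→ₗ[k] k) (u : V) :
    ∃ L : V →ₗ[k] V, ∀ w x, β (L w) x = γ.toTrilin u w x := by
  have hinj : Function.Injective β := by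
    rw [injective_iff_map_eq_zero]
    exact fun u hu => hβnd u fun v => by rw [hu, LinearMap.zero_apply]
  let e := LinearEquiv.ofInjectiveOfFinrankEq β hinj Subspace.dual_finrank_eq.symm
  refine ⟨e.symm.toLinearMap ∘ₗ γ.toTrilin u, fun w x => ?_⟩
  have h : β (e.symm (γ.toTrilin u w)) = γ.toTrilin u w :=
    e.apply_symm_apply _
  exact congrArg (fun f : V →ₗ[k] k => f x) h

theorem two_smul_cross_cross (hchar : (2 : k) ≠ 0) (β : V →ₗ[k] V →ₗ[k] k)
    (hβsymm : ∀ u v : V, β u v = β v u)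
    (hβnd : ∀ u : V, (∀ v : V, β u v = 0) → u = 0) (γ : V [⋀^Fin 3]→ₗ[k] k)
    (hcompat : ∀ u v : V, ∃ d : V, (∀ x : V, β d x = γ ![u, v, x]) ∧
      2 * γ ![u, v, d] = β u u * β v v - (β u v) ^ 2)
    {u : V} {L : V →ₗ[k] V} (hL : ∀ w x, β (L w) x = γ.toTrilin u w x) (w : V) :
    (2 : k) • L (L w) = β u w • u - β u u • w := by
  have norm_sq (w : V) : 2 * β (L w) (L w) = β u u * β w w - (β u w) ^ 2 := by
    obtain ⟨d, hd, h⟩ := hcompat u w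
    have : d = L w := by
      refine sub_eq_zero.1 (hβnd _ fun x => ?_)
      rw [map_sub, LinearMap.sub_apply, hd, hL, γ.toTrilin_apply, sub_self]
    rw [hL, γ.toTrilin_apply, ← this, h]
  refine sub_eq_zero.1 (hβnd _ fun x => ?_)
  have skew : β (L (L w)) x = -β (L w) (L x) := by
    rw [hL, γ.toTrilin_swap, ← hL, hβsymm]
  have h := norm_sq (w + x)
  simp only [map_add, LinearMap.add_apply] at h
  have hw := norm_sq w
  have hx := norm_sq x
  have hs := hβsymm (L x) (L w)
  have hs' := hβsymm x w
  simp only [map_sub, map_smul, LinearMap.sub_apply, LinearMap.smul_apply, smul_eq_mul, skew]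
  refine (mul_eq_zero.1 ?_).resolve_left hchar
  rw [hs, hs'] at h
  linear_combination -h + hw + hx

theorem finrank_span_singleton_le_one (v : V) : finrank k (Submodule.span k {v}) ≤ 1 := by
  simpa using finrank_span_le_card (R := k) ({v} : Set V)

/-- If `L ∘ L` vanishes on a subspace of dimension at least `3`, then `ker L` is not
contained in a line. -/
theorem exists_ker_notMem_span [FiniteDimensional k V] (L : V →ₗ[k] V) (H : Submodule k V)
    (hH : 3 ≤ finrank k H) (hL : ∀ x ∈ H, L (L x) = 0) (v : V) :
    ∃ w, L w = 0 ∧ w ∉ Submodule.span k {v} := by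
  by_contra! h
  have hker : finrank k (LinearMap.ker L) ≤ 1 :=
    (Submodule.finrank_mono (fun w hw => h w hw)).trans (finrank_span_singleton_le_one v)
  have hrange : finrank k (LinearMap.range (L.domRestrict H)) ≤ finrank k (LinearMap.ker L) := by
    refine Submodule.finrank_mono ?_
    rintro _ ⟨x, rfl⟩
    exact hL x x.2
  have hker' : finrank k (LinearMap.ker (L.domRestrict H)) ≤ finrank k (LinearMap.ker L) := by
    rw [LinearEquiv.finrank_eq (Submodule.equivMapOfInjective H.subtype H.injective_subtype _)]
    refine Submodule.finrank_mono ?_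
    rintro _ ⟨x, hx, rfl⟩
    exact hx
  have := (L.domRestrict H).finrank_range_add_finrank_ker
  omega

end CrossProduct

/-- For a nondegenerate alternating trilinear form `γ` with compatible
nondegenerate symmetric bilinear form `β` on a 7-dimensional space, a nonzero vector `v`
lies in some 2-dimensional `γ`-isotropic subspace iff `β(v,v) = 0`. -/
theorem gammaIsotropic_vector_iff_betaIsotropic
    {k : Type*} [Field k] [IsAlgClosed k] (hchar : (2 : k) ≠ 0)
    {V : Type*} [AddCommGroup V] [Module k V] [FiniteDimensional k V]
    (hdim : finrank k V = 7)
    (β : V →ₗ[k] V →ₗ[k] k)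
    (hβsymm : ∀ u v : V, β u v = β v u)
    (hβnd : ∀ u : V, (∀ v : V, β u v = 0) → u = 0)
    (γ : V [⋀^Fin 3]→ₗ[k] k)
    (hcompat : ∀ u v : V, ∃ d : V, (∀ x : V, β d x = γ ![u, v, x]) ∧
      2 * γ ![u, v, d] = β u u * β v v - (β u v) ^ 2)
    (v : V) (hv : v ≠ 0) :
    (∃ W : Submodule k V, finrank k W = 2 ∧
        (∀ a ∈ W, ∀ b ∈ W, ∀ x : V, γ ![a, b, x] = 0) ∧ v ∈ W) ↔
      β v v = 0 := by
  obtain ⟨L, hL⟩ := exists_cross_left β hβnd γ v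
  have hLL := two_smul_cross_cross hchar β hβsymm hβnd γ hcompat hL
  constructor
  · rintro ⟨W, hW, hiso, hvW⟩
    obtain ⟨w, hwW, hw⟩ : ∃ w ∈ W, w ∉ Submodule.span k {v} := by
      by_contra! h
      have := (Submodule.finrank_mono h).trans (finrank_span_singleton_le_one (k := k) v)
      omega
    have hLw : L w = 0 := hβnd _ fun x => (hL w x).trans (hiso v hvW w hwW x)
    have h := hLL w
    rw [hLw, map_zero, smul_zero, eq_comm, sub_eq_zero] at h
    by_contra hvv
    refine hw (Submodule.mem_span_singleton.2 ⟨(β v v)⁻¹ * β v w, ?_⟩)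
    rw [mul_smul, h, inv_smul_smul₀ hvv]
  · intro hvv
    have hH : 3 ≤ finrank k (LinearMap.ker (β v)) := by
      have := (β v).finrank_range_add_finrank_ker
      have := (LinearMap.range (β v)).finrank_le
      rw [finrank_self] at this
      omega
    obtain ⟨w, hLw, hw⟩ := exists_ker_notMem_span L _ hH (fun x hx => by
      have h := hLL x
      rw [LinearMap.mem_ker.1 hx, hvv, zero_smul, zero_smul, sub_zero] at h
      exact (smul_eq_zero.1 h).resolve_left hchar) v
    have hind : LinearIndependent k ![v, w] := by
      rw [LinearIndependent.pair_iff' hv]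
      exact fun a ha => hw (Submodule.mem_span_singleton.2 ⟨a, ha⟩)
    have hvw (x : V) : γ.toTrilin v w x = 0 := by
      rw [← hL, hLw, map_zero, LinearMap.zero_apply]
    have hwv (x : V) : γ.toTrilin w v x = 0 := by
      have h := γ.toTrilin_self (v + w) x
      simpa only [map_add, LinearMap.add_apply, γ.toTrilin_self, hvw, zero_add, add_zero] using h
    refine ⟨Submodule.span k {v, w}, ?_, ?_, Submodule.subset_span (by simp)⟩
    · rw [← Matrix.range_cons_cons_empty v w ![], finrank_span_eq_card hind, Fintype.card_fin]
    · intro a ha b hb x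
      obtain ⟨p, q, rfl⟩ := Submodule.mem_span_pair.1 ha
      obtain ⟨r, s, rfl⟩ := Submodule.mem_span_pair.1 hb
      rw [← γ.toTrilin_apply]
      simp only [map_add, map_smul, LinearMap.add_apply, LinearMap.smul_apply, γ.toTrilin_self,
        hvw, hwv, smul_zero, add_zero]
end
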